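/- Let κ = (ν,P,P̂,U) ∈ K_n with U real and with p, p̂ probability vectors with all entries positive, let θ̂ ≠ 0 be real, R = θ̂ P̂ Uᵀ = (r_{kl}), Q = R^{−1} = (q_{kl}), and let K(ξ,η) be the multivariate Krawtchouk polynomials associated with κ and 2j. Then for all 0 ≤ i ≠ m ≤ n and all ξ, η ∈ Ω_{2j}: √(p̂_m/p̂_i) · ξ_i · K(ξ − e_i + e_m, η) = √(p̂_i/p̂_m) Σ_{k,l=0}^n q_{ki} r_{ml} η_l K(ξ, η + e_k − e_l). In other words, [ρ_{p̂}(e_{im}*) K(·,η)](ξ) = [σ_p(e_{im}) K(ξ,·)](η), where ρ_{p̂}(e_{mi})f(ξ) = √(p̂_m/p̂_i) ξ_i f(ξ − e_i + e_m) and σ_p(e_{im})f(η) = √(p̂_i/p̂_m) Σ_{k,l} q_{ki} r_{ml} η_l f(η + e_k − e_l). -/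

import Mathlib

/-- The state space `Ω_{2j}`; `m` plays the role of `2j`. -/
def Omega (n m : ℕ) : Finset (Fin (n + 1) → ℕ) :=
  Finset.Nat.antidiagonalTuple (n + 1) m

/-- `conf η k l = η + e_k − e_l` (truncated subtraction on ℕ). -/
def conf {d : ℕ} (ξ : Fin d → ℕ) (k l : Fin d) : Fin d → ℕ :=
  fun i => (if i = k then ξ i + 1 else ξ i) - (if i = l then 1 else 0)

/-- The matrix `R = θ̂ P̂ Uᵀ`. -/
noncomputable def Rmat (n : ℕ) (θ : ℝ) (phat : Fin (n + 1) → ℝ)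
    (U : Matrix (Fin (n + 1)) (Fin (n + 1)) ℝ) : Matrix (Fin (n + 1)) (Fin (n + 1)) ℝ :=
  θ • (Matrix.diagonal phat * U.transpose)

/-- `σ_p(e_{im})f(η) = √(p̂_i/p̂_m) Σ_{k,l} q_{ki} r_{ml} η_l f(η + e_k − e_l)`, with
`R = θ̂ P̂ Uᵀ = (r_{kl})`, `Q = R⁻¹ = (q_{kl})`. -/
noncomputable def sigmaOp (n : ℕ) (θ : ℝ) (phat : Fin (n + 1) → ℝ)
    (U : Matrix (Fin (n + 1)) (Fin (n + 1)) ℝ) (i m' : Fin (n + 1))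
    (f : (Fin (n + 1) → ℕ) → ℝ) (η : Fin (n + 1) → ℕ) : ℝ :=
  Real.sqrt (phat i / phat m') *
    ∑ k : Fin (n + 1), ∑ l : Fin (n + 1),
      (Rmat n θ phat U)⁻¹ k i * Rmat n θ phat U m' l * (η l : ℝ) * f (conf η k l)

open MvPolynomial in
/-- The linear form `L_k = Σ_l u_{kl} X_l`. -/
noncomputable def Lform {d : ℕ} (U : Matrix (Fin d) (Fin d) ℝ) (k : Fin d) :
    MvPolynomial (Fin d) ℝ := ∑ l, C (U k l) * X l

/-- The product `Π_k L_k ^ η_k`. -/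
noncomputable def Aprod {d : ℕ} (U : Matrix (Fin d) (Fin d) ℝ) (η : Fin d → ℕ) :
    MvPolynomial (Fin d) ℝ := ∏ k, Lform U k ^ η k

/-- A tuple as a finitely supported function. -/
noncomputable def fsp {d : ℕ} (ξ : Fin d → ℕ) : Fin d →₀ ℕ := Finsupp.equivFunOnFinite.symm ξ

lemma pderiv_prod_aux {d : ℕ} (m : Fin d) (f : Fin d → MvPolynomial (Fin d) ℝ)
    (s : Finset (Fin d)) :
    MvPolynomial.pderiv m (∏ k ∈ s, f k) =
      ∑ l ∈ s, (∏ k ∈ s.erase l, f k) * MvPolynomial.pderiv m (f l) := by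
  classical
  induction s using Finset.induction_on with
  | empty => simp
  | insert a s ha ih =>
    rw [Finset.prod_insert ha, MvPolynomial.pderiv_mul, ih, Finset.sum_insert ha,
      Finset.erase_insert ha, Finset.mul_sum]
    congr 1
    · ring
    · refine Finset.sum_congr rfl fun l hl => ?_
      have hal : a ≠ l := fun h => ha (h ▸ hl)
      rw [Finset.erase_insert_of_ne hal, Finset.prod_insert
        (fun h => ha (Finset.mem_of_mem_erase h))]
      ring

lemma pderiv_Lform {d : ℕ} (U : Matrix (Fin d) (Fin d) ℝ) (k m : Fin d) :
    MvPolynomial.pderiv m (Lform U k) = MvPolynomial.C (U k m) := by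
  classical
  unfold Lform
  rw [map_sum, Finset.sum_eq_single m]
  · simp
  · intro b _ hb
    simp [MvPolynomial.pderiv_X_of_ne hb]
  · simp

lemma Aprod_conf {d : ℕ} (U : Matrix (Fin d) (Fin d) ℝ) (η : Fin d → ℕ) (k l : Fin d)
    (h : 1 ≤ η l) :
    Aprod U (conf η k l) =
      Lform U k * (Lform U l ^ (η l - 1) * ∏ a ∈ Finset.univ.erase l, Lform U a ^ η a) := by
  classical
  have h1 : ∀ a, conf η k l a = (if a = k then 1 else 0) + (η a - if a = l then 1 else 0) := by
    intro a
    unfold conf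
    by_cases hal : a = l
    · subst hal
      split_ifs <;> omega
    · split_ifs <;> omega
  unfold Aprod
  simp only [h1, pow_add, Finset.prod_mul_distrib]
  congr 1
  · simp
  · rw [← Finset.mul_prod_erase _ _ (Finset.mem_univ l)]
    congr 1
    · simp
    · refine Finset.prod_congr rfl fun a ha => ?_
      simp [Finset.ne_of_mem_erase ha]

lemma X_mul_pderiv_Aprod {d : ℕ} (U V : Matrix (Fin d) (Fin d) ℝ) (hV : V * U = 1)
    (η : Fin d → ℕ) (i m : Fin d) :
    MvPolynomial.X i * MvPolynomial.pderiv m (Aprod U η) =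
      ∑ k, ∑ l, MvPolynomial.C (V i k * U l m * (η l : ℝ)) * Aprod U (conf η k l) := by
  classical
  have hX : (MvPolynomial.X i : MvPolynomial (Fin d) ℝ) =
      ∑ k, MvPolynomial.C (V i k) * Lform U k := by
    unfold Lform
    simp only [Finset.mul_sum]
    rw [Finset.sum_comm]
    have h2 : ∀ l, ∑ k, (MvPolynomial.C (V i k) * (MvPolynomial.C (U k l) * MvPolynomial.X l) :
        MvPolynomial (Fin d) ℝ) = MvPolynomial.C ((V * U) i l) * MvPolynomial.X l := by
      intro l
      rw [Matrix.mul_apply, map_sum, Finset.sum_mul]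
      refine Finset.sum_congr rfl fun k _ => ?_
      rw [map_mul]; ring
    simp only [h2, hV, Matrix.one_apply]
    simp
  rw [hX, Finset.sum_mul]
  refine Finset.sum_congr rfl fun k _ => ?_
  conv_lhs => unfold Aprod
  rw [pderiv_prod_aux, Finset.mul_sum]
  refine Finset.sum_congr rfl fun l _ => ?_
  rw [MvPolynomial.pderiv_pow, pderiv_Lform]
  by_cases h0 : η l = 0
  · simp [h0]
  · rw [Aprod_conf U η k l (by omega)]
    simp only [map_mul, map_natCast]
    ring

lemma gen_hom (n m : ℕ) (U : Matrix (Fin (n + 1)) (Fin (n + 1)) ℝ)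
    (hU0 : ∀ k, U k 0 = 1) (c : (Fin (n + 1) → ℕ) → ℝ)
    (η : Fin (n + 1) → ℕ) (hη : η ∈ Omega n m)
    (hK : ∀ z : Fin (n + 1) → ℝ,
      ∑ ξ ∈ Omega n m, c ξ * ∏ l ∈ Finset.univ.erase (0 : Fin (n + 1)), z l ^ ξ l =
        ∏ k : Fin (n + 1),
          (1 + ∑ l ∈ Finset.univ.erase (0 : Fin (n + 1)), U k l * z l) ^ η k) :
    ∑ ξ ∈ Omega n m, MvPolynomial.monomial (fsp ξ) (c ξ) = Aprod U η := by
  classical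
  have hX : (MvPolynomial.X 0 : MvPolynomial (Fin (n + 1)) ℝ) ≠ 0 := MvPolynomial.X_ne_zero 0
  apply mul_left_cancel₀ hX
  apply MvPolynomial.funext
  intro z
  rw [map_mul, map_mul, MvPolynomial.eval_X]
  by_cases hz : z 0 = 0
  · simp [hz]
  congr 1
  have h1 : ∀ ξ ∈ Omega n m, MvPolynomial.eval z (MvPolynomial.monomial (fsp ξ) (c ξ)) =
      z 0 ^ m * (c ξ * ∏ l ∈ Finset.univ.erase (0 : Fin (n + 1)), (z l / z 0) ^ ξ l) := by
    intro ξ hξ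
    have hs : ∑ a, ξ a = m := Finset.Nat.mem_antidiagonalTuple.1 hξ
    rw [MvPolynomial.eval_monomial, Finsupp.prod_fintype _ _ (by simp)]
    have h3 : ∏ a, z a ^ fsp ξ a = z 0 ^ m * ∏ a, (z a / z 0) ^ ξ a := by
      rw [← hs, ← Finset.prod_pow_eq_pow_sum, ← Finset.prod_mul_distrib]
      refine Finset.prod_congr rfl fun a _ => ?_
      rw [← mul_pow, mul_div_cancel₀ _ hz]
      rfl
    rw [h3, ← Finset.mul_prod_erase _ _ (Finset.mem_univ (0 : Fin (n + 1))), div_self hz]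
    ring
  rw [map_sum, Finset.sum_congr rfl h1, ← Finset.mul_sum, hK (fun l => z l / z 0)]
  have hs : ∑ a, η a = m := Finset.Nat.mem_antidiagonalTuple.1 hη
  rw [← hs, ← Finset.prod_pow_eq_pow_sum, ← Finset.prod_mul_distrib]
  unfold Aprod Lform
  simp only [map_prod, map_pow, map_sum, map_mul, MvPolynomial.eval_C, MvPolynomial.eval_X]
  refine Finset.prod_congr rfl fun k _ => ?_
  rw [← mul_pow, ← Finset.add_sum_erase _ _ (Finset.mem_univ (0 : Fin (n + 1))), hU0 k, mul_add,
    Finset.mul_sum]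
  congr 2
  · ring
  · refine Finset.sum_congr rfl fun l _ => ?_
    field_simp

lemma conf_mem {n m : ℕ} {η : Fin (n + 1) → ℕ} (hη : η ∈ Omega n m) (k l : Fin (n + 1))
    (h : 1 ≤ η l) : conf η k l ∈ Omega n m := by
  classical
  have hs : ∑ a, η a = m := Finset.Nat.mem_antidiagonalTuple.1 hη
  apply Finset.Nat.mem_antidiagonalTuple.2
  have h1 : ∀ a, conf η k l a + (if a = l then 1 else 0) = η a + (if a = k then 1 else 0) := by
    intro a
    unfold conf
    by_cases hal : a = l
    · subst hal
      split_ifs <;> omega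
    · split_ifs <;> omega
  have h2 := Finset.sum_congr rfl (fun a (_ : a ∈ Finset.univ) => h1 a)
  simp only [Finset.sum_add_distrib] at h2
  simp at h2
  omega

lemma fsp_injective {d : ℕ} : Function.Injective (fsp : (Fin d → ℕ) → (Fin d →₀ ℕ)) :=
  Finsupp.equivFunOnFinite.symm.injective

lemma coeff_side (n m : ℕ) (c : (Fin (n + 1) → ℕ) → ℝ) (ξ : Fin (n + 1) → ℕ)
    (hξ : ξ ∈ Omega n m) :
    MvPolynomial.coeff (fsp ξ) (∑ ξ ∈ Omega n m, MvPolynomial.monomial (fsp ξ) (c ξ)) = c ξ := by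
  classical
  rw [MvPolynomial.coeff_sum, Finset.sum_eq_single ξ]
  · simp
  · intro b _ hb
    rw [MvPolynomial.coeff_monomial, if_neg (fun h => hb (fsp_injective h))]
  · intro h; exact absurd hξ h

lemma inter_basic (n m : ℕ)
    (U V : Matrix (Fin (n + 1)) (Fin (n + 1)) ℝ) (hV : V * U = 1)
    (K : (Fin (n + 1) → ℕ) → (Fin (n + 1) → ℕ) → ℝ)
    (hA : ∀ η ∈ Omega n m, ∀ ξ ∈ Omega n m, MvPolynomial.coeff (fsp ξ) (Aprod U η) =
      ((Nat.factorial m : ℝ) / ∏ i, (Nat.factorial (ξ i) : ℝ)) * K ξ η)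
    (i m' : Fin (n + 1)) (him : i ≠ m') (ξ : Fin (n + 1) → ℕ) (hξ : ξ ∈ Omega n m)
    (η : Fin (n + 1) → ℕ) (hη : η ∈ Omega n m) :
    (ξ i : ℝ) * K (conf ξ m' i) η =
      ∑ k, ∑ l, V i k * U l m' * (η l : ℝ) * K ξ (conf η k l) := by
  classical
  have hc : ((Nat.factorial m : ℝ) / ∏ i, (Nat.factorial (ξ i) : ℝ)) ≠ 0 :=
    div_ne_zero (by positivity) (Finset.prod_ne_zero_iff.2 fun a _ => by positivity)
  have key := congrArg (MvPolynomial.coeff (fsp ξ)) (X_mul_pderiv_Aprod U V hV η i m')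
  have hR : MvPolynomial.coeff (fsp ξ)
      (∑ k, ∑ l, MvPolynomial.C (V i k * U l m' * (η l : ℝ)) * Aprod U (conf η k l)) =
      ((Nat.factorial m : ℝ) / ∏ i, (Nat.factorial (ξ i) : ℝ)) *
        ∑ k, ∑ l, V i k * U l m' * (η l : ℝ) * K ξ (conf η k l) := by
    simp only [MvPolynomial.coeff_sum, Finset.mul_sum, MvPolynomial.coeff_C_mul]
    refine Finset.sum_congr rfl fun k _ => Finset.sum_congr rfl fun l _ => ?_
    by_cases h0 : η l = 0
    · simp [h0]
    · rw [hA _ (conf_mem hη k l (by omega)) _ hξ]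
      ring
  rw [hR] at key
  apply mul_left_cancel₀ hc
  rw [← key, MvPolynomial.coeff_X_mul']
  by_cases h0 : ξ i = 0
  · have : i ∉ (fsp ξ).support := by
      rw [Finsupp.notMem_support_iff]; exact h0
    simp [this, h0]
  · have : i ∈ (fsp ξ).support := by
      rw [Finsupp.mem_support_iff]; exact h0
    rw [if_pos this, MvPolynomial.coeff_pderiv]
    have e1 : fsp ξ - Finsupp.single i 1 + Finsupp.single m' 1 = fsp (conf ξ m' i) := by
      ext a
      simp only [Finsupp.add_apply, Finsupp.tsub_apply, Finsupp.single_apply]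
      change ξ a - _ + _ = conf ξ m' i a
      unfold conf
      by_cases hai : a = i
      · subst hai; simp [him, him.symm]
      · by_cases ham : a = m'
        · subst ham; simp [him, him.symm]
        · simp [hai, ham, Ne.symm hai, Ne.symm ham]
    have e2 : (fsp ξ - Finsupp.single i 1 : Fin (n + 1) →₀ ℕ) m' = ξ m' := by
      simp [him, fsp]
    rw [e1, e2, hA _ hη _ (conf_mem hξ m' i (by omega))]
    have e3 : (∏ a, (Nat.factorial (conf ξ m' i a) : ℝ)) * (ξ i : ℝ) =
        (∏ a, (Nat.factorial (ξ a) : ℝ)) * ((ξ m' : ℝ) + 1) := by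
      have hm1 : m' ∈ Finset.univ.erase i := Finset.mem_erase.2 ⟨him.symm, Finset.mem_univ _⟩
      rw [← Finset.mul_prod_erase _ _ (Finset.mem_univ i), ← Finset.mul_prod_erase _ _ hm1,
        ← Finset.mul_prod_erase _ (fun a => (Nat.factorial (ξ a) : ℝ)) (Finset.mem_univ i),
        ← Finset.mul_prod_erase _ (fun a => (Nat.factorial (ξ a) : ℝ)) hm1]
      have hp : ∏ a ∈ (Finset.univ.erase i).erase m', (Nat.factorial (conf ξ m' i a) : ℝ) =
          ∏ a ∈ (Finset.univ.erase i).erase m', (Nat.factorial (ξ a) : ℝ) := by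
        refine Finset.prod_congr rfl fun a ha => ?_
        simp only [Finset.mem_erase] at ha
        simp [conf, ha.1, ha.2.1]
      have hi : conf ξ m' i i = ξ i - 1 := by simp [conf, him]
      have hm : conf ξ m' i m' = ξ m' + 1 := by simp [conf, him.symm]
      rw [hp, hi, hm, Nat.factorial_succ, ← Nat.mul_factorial_pred h0]
      push_cast
      ring
    have n1 : (∏ a, (Nat.factorial (conf ξ m' i a) : ℝ)) ≠ 0 :=
      Finset.prod_ne_zero_iff.2 fun a _ => by positivity
    have n2 : (∏ a, (Nat.factorial (ξ a) : ℝ)) ≠ 0 :=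
      Finset.prod_ne_zero_iff.2 fun a _ => by positivity
    field_simp
    linear_combination (K (conf ξ m' i) η) * e3

/-- Intertwining relation `[ρ_{p̂}(e_{im}*) K(·,η)](ξ) = [σ_p(e_{im}) K(ξ,·)](η)` for the
multivariate Krawtchouk polynomials. -/
theorem krawtchouk_intertwining (n m : ℕ) (hn : 1 ≤ n) (hm : 0 < m)
    (ν : ℝ) (hν : ν ≠ 0) (p phat : Fin (n + 1) → ℝ)
    (U : Matrix (Fin (n + 1)) (Fin (n + 1)) ℝ)
    (hp0 : p 0 = 1 / ν) (hphat0 : phat 0 = 1 / ν)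
    (hU0 : ∀ k, U k 0 = 1 ∧ U 0 k = 1)
    (hmain : ν • (Matrix.diagonal p * U * Matrix.diagonal phat * U.transpose) = 1)
    (hp : ∀ i, 0 < p i) (hp1 : ∑ i, p i = 1)
    (hphat : ∀ i, 0 < phat i) (hphat1 : ∑ i, phat i = 1)
    (θ : ℝ) (hθ : θ ≠ 0)
    (K : (Fin (n + 1) → ℕ) → (Fin (n + 1) → ℕ) → ℝ)
    (hK : ∀ η ∈ Omega n m, ∀ z : Fin (n + 1) → ℝ,
      ∑ ξ ∈ Omega n m,
          ((Nat.factorial m : ℝ) / ∏ i, (Nat.factorial (ξ i) : ℝ)) * K ξ η *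
            ∏ l ∈ Finset.univ.erase (0 : Fin (n + 1)), z l ^ ξ l =
        ∏ k : Fin (n + 1),
          (1 + ∑ l ∈ Finset.univ.erase (0 : Fin (n + 1)), U k l * z l) ^ η k) :
    ∀ i m' : Fin (n + 1), i ≠ m' → ∀ ξ ∈ Omega n m, ∀ η ∈ Omega n m,
      Real.sqrt (phat m' / phat i) * (ξ i : ℝ) * K (conf ξ m' i) η =
        sigmaOp n θ phat U i m' (fun η' => K ξ η') η := by
  intro i m' him ξ hξ η hη
  have hA : ∀ η ∈ Omega n m, ∀ ξ ∈ Omega n m, MvPolynomial.coeff (fsp ξ) (Aprod U η) =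
      ((Nat.factorial m : ℝ) / ∏ i, (Nat.factorial (ξ i) : ℝ)) * K ξ η := by
    intro η hη ξ hξ
    rw [← gen_hom n m U (fun k => (hU0 k).1)
      (fun ξ => ((Nat.factorial m : ℝ) / ∏ i, (Nat.factorial (ξ i) : ℝ)) * K ξ η) η hη (hK η hη)]
    exact coeff_side n m _ ξ hξ
  obtain ⟨V, hV⟩ : ∃ V : Matrix (Fin (n + 1)) (Fin (n + 1)) ℝ, V * U = 1 := by
    refine ⟨ν • (Matrix.diagonal phat * U.transpose * Matrix.diagonal p), ?_⟩
    have h1 : Matrix.diagonal p * (U * (ν • (Matrix.diagonal phat * U.transpose))) = 1 := by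
      rw [← hmain]
      simp only [Matrix.mul_smul, Matrix.mul_assoc]
    have h2 := mul_eq_one_comm.1 h1
    rw [Matrix.mul_assoc] at h2
    have h3 := mul_eq_one_comm.1 h2
    rw [← h3]
    simp only [Matrix.smul_mul]
  have hUV : U * V = 1 := mul_eq_one_comm.1 hV
  have hb := inter_basic n m U V hV K hA i m' him ξ hξ η hη
  have hinv : (Rmat n θ phat U)⁻¹ =
      θ⁻¹ • (V.transpose * Matrix.diagonal (fun a => (phat a)⁻¹)) := by
    apply Matrix.inv_eq_left_inv
    unfold Rmat
    rw [Matrix.smul_mul, Matrix.mul_smul, smul_smul, inv_mul_cancel₀ hθ, one_smul,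
      Matrix.mul_assoc, ← Matrix.mul_assoc (Matrix.diagonal _) (Matrix.diagonal _),
      Matrix.diagonal_mul_diagonal]
    have : (fun a => (phat a)⁻¹ * phat a) = fun _ => 1 := by
      funext a
      exact inv_mul_cancel₀ (hphat a).ne'
    rw [this, Matrix.diagonal_one, Matrix.one_mul, ← Matrix.transpose_mul, hUV,
      Matrix.transpose_one]
  have hi := hphat i
  have hm2 := hphat m'
  have hq : ∀ k l, (Rmat n θ phat U)⁻¹ k i * Rmat n θ phat U m' l =
      (phat m' / phat i) * (V i k * U l m') := by
    intro k l
    rw [hinv]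
    unfold Rmat
    rw [Matrix.smul_apply, Matrix.smul_apply, Matrix.mul_diagonal, Matrix.diagonal_mul,
      Matrix.transpose_apply, Matrix.transpose_apply, smul_eq_mul, smul_eq_mul]
    field_simp
  have hsq : Real.sqrt (phat i / phat m') * (phat m' / phat i) = Real.sqrt (phat m' / phat i) := by
    have hpos : 0 < phat m' / phat i := div_pos hm2 hi
    rw [← inv_div (phat m') (phat i), Real.sqrt_inv]
    nth_rewrite 2 [← Real.mul_self_sqrt hpos.le]
    have := (Real.sqrt_pos.2 hpos).ne'
    field_simp
  unfold sigmaOp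
  simp only [hq]
  rw [mul_assoc, hb, ← hsq, mul_assoc]
  congr 1
  simp only [Finset.mul_sum]
  refine Finset.sum_congr rfl fun k _ => Finset.sum_congr rfl fun l _ => ?_
  ring
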